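/- arXiv:1209.6120 — 2 statements merged into one kernel-verified Lean document; each statement's English description precedes it below -/
import Mathlib

section
/- Let s_n = r_0 + r_1 + … + r_{n−1} for n ≥ 1, and for j ∈ ℤ \ {0} let τ_j = inf{n ≥ 1 : s_n = j} (with τ_j = ∞ if no such n exists, and (1/2)^∞ interpreted as 0). Then the maximum value of f over [0,1] is M(f) = Σ_{k=1}^∞ (1/2)^{τ_{2k−1}}. -/
/-- `phi x` is the distance from `x` to the nearest integer. -/
noncomputable def phi (x : ℝ) : ℝ := |x - round x|

/-- The signed Takagi function associated to the sign sequence `r`. -/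
noncomputable def takagi (r : ℕ → ℝ) (x : ℝ) : ℝ :=
  ∑' n : ℕ, r n / 2 ^ n * phi (2 ^ n * x)

/-- `tau r j` is the first time `n ≥ 1` at which the partial sum
`s_n = r_0 + ⋯ + r_{n-1}` equals `j` (and `⊤` if there is no such time). -/
noncomputable def tau (r : ℕ → ℝ) (j : ℤ) : ℕ∞ :=
  sInf {t : ℕ∞ | ∃ n : ℕ, (n : ℕ∞) = t ∧ 1 ≤ n ∧ (∑ i ∈ Finset.range n, r i) = (j : ℝ)}

/-- `(1/2)^t` for `t ∈ ℕ∞`, with the convention `(1/2)^∞ = 0`. -/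
noncomputable def halfPow (t : ℕ∞) : ℝ :=
  WithTop.recTopCoe 0 (fun n : ℕ => (1 / 2 : ℝ) ^ n) t

theorem phi_eq_norm (x : ℝ) : phi x = ‖(x : UnitAddCircle)‖ :=
  UnitAddCircle.norm_eq.symm

theorem continuous_phi : Continuous phi := by
  rw [funext phi_eq_norm]
  exact continuous_norm.comp (AddCircle.continuous_mk' 1)

theorem phi_natCast_sub (m : ℕ) (x : ℝ) : phi (m - x) = phi x := by
  rw [phi_eq_norm, phi_eq_norm]
  have h : ((m : ℝ) : UnitAddCircle) = 0 :=
    (AddCircle.coe_eq_zero_iff 1).2 ⟨m, by simp⟩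
  rw [AddCircle.coe_sub, h, zero_sub, norm_neg]

theorem abs_phi_le_one (x : ℝ) : |phi x| ≤ 1 := by
  rw [phi, abs_abs]
  linarith [abs_sub_round x]

theorem phi_eq_self {x : ℝ} (h0 : 0 ≤ x) (h1 : x ≤ 1 / 2) : phi x = x := by
  rw [phi, abs_sub_round_eq_min, Int.fract_eq_self.2 ⟨h0, by linarith⟩]
  exact min_eq_left (by linarith)

theorem takagi_one_sub (r : ℕ → ℝ) (x : ℝ) : takagi r (1 - x) = takagi r x := by
  unfold takagi
  refine tsum_congr fun n => ?_
  have h := phi_natCast_sub (2 ^ n) (2 ^ n * x)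
  push_cast at h
  rw [mul_sub, mul_one, h]

section Takagi

variable {r : ℕ → ℝ} (hr : ∀ n, r n = 1 ∨ r n = -1)
include hr

theorem norm_takagi_term_le (n : ℕ) (x : ℝ) :
    ‖r n / 2 ^ n * phi (2 ^ n * x)‖ ≤ (1 / 2 : ℝ) ^ n := by
  have h : |r n| = 1 := by rcases hr n with h | h <;> simp [h]
  rw [Real.norm_eq_abs, abs_mul, abs_div, h, abs_of_pos (by positivity : (0 : ℝ) < 2 ^ n),
    one_div_pow]
  exact mul_le_of_le_one_right (by positivity) (abs_phi_le_one _)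

theorem summable_takagi (x : ℝ) : Summable fun n : ℕ => r n / 2 ^ n * phi (2 ^ n * x) :=
  summable_geometric_two.of_norm_bounded fun n => norm_takagi_term_le hr n x

theorem continuous_takagi : Continuous (takagi r) :=
  continuous_tsum (fun _ => continuous_const.mul (continuous_phi.comp (continuous_const_mul _)))
    summable_geometric_two (norm_takagi_term_le hr)

theorem takagi_le_two (x : ℝ) : takagi r x ≤ 2 :=
  (Real.le_norm_self _).trans
    (tsum_of_norm_bounded hasSum_geometric_two fun n => norm_takagi_term_le hr n x)

theorem takagi_half {y : ℝ} (h0 : 0 ≤ y) (h1 : y ≤ 1) :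
    takagi r (y / 2) = (r 0 * y + takagi (fun n => r (n + 1)) y) / 2 := by
  unfold takagi
  rw [(summable_takagi hr _).tsum_eq_zero_add]
  have h : ∀ n : ℕ, r (n + 1) / 2 ^ (n + 1) * phi (2 ^ (n + 1) * (y / 2)) =
      1 / 2 * (r (n + 1) / 2 ^ n * phi (2 ^ n * y)) := fun n => by
    rw [show (2 : ℝ) ^ (n + 1) * (y / 2) = 2 ^ n * y by ring, pow_succ]
    field_simp
  rw [tsum_congr h, tsum_mul_left, pow_zero, one_mul, phi_eq_self (by linarith) (by linarith)]
  ring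

end Takagi

theorem halfPow_top : halfPow ⊤ = 0 := rfl

theorem halfPow_natCast (n : ℕ) : halfPow n = (1 / 2) ^ n := rfl

theorem halfPow_nonneg (t : ℕ∞) : 0 ≤ halfPow t := by
  induction t using ENat.recTopCoe with
  | top => rw [halfPow_top]
  | coe n => rw [halfPow_natCast]; positivity

theorem halfPow_add_one (t : ℕ∞) : halfPow (t + 1) = halfPow t / 2 := by
  induction t using ENat.recTopCoe with
  | top => rw [top_add, halfPow_top, zero_div]
  | coe n =>
    rw [show (n : ℕ∞) + 1 = ((n + 1 : ℕ) : ℕ∞) by push_cast; rfl, halfPow_natCast,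
      halfPow_natCast, pow_succ]
    ring

theorem halfPow_le_of_le {t : ℕ∞} {n : ℕ} (h : (n : ℕ∞) ≤ t) : halfPow t ≤ (1 / 2) ^ n := by
  induction t using ENat.recTopCoe with
  | top => rw [halfPow_top]; positivity
  | coe m =>
    rw [halfPow_natCast]
    exact pow_le_pow_of_le_one (by norm_num) (by norm_num) (by exact_mod_cast h)

theorem tau_eq_one {r : ℕ → ℝ} {j : ℤ} (h : r 0 = j) : tau r j = 1 := by
  refine le_antisymm (sInf_le ⟨1, by simp, le_rfl, by simpa using h⟩) (le_sInf ?_)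
  rintro _ ⟨n, rfl, hn, -⟩
  exact_mod_cast hn

theorem tau_eq_tau_shift_add_one {r : ℕ → ℝ} {i j : ℤ} (h : r 0 + i = j) (hi : i ≠ 0) :
    tau r j = tau (fun n => r (n + 1)) i + 1 := by
  refine le_antisymm ?_ (le_sInf ?_)
  · rcases Set.eq_empty_or_nonempty {t : ℕ∞ | ∃ n : ℕ, (n : ℕ∞) = t ∧ 1 ≤ n ∧
        (∑ k ∈ Finset.range n, r (k + 1)) = (i : ℝ)} with he | hne
    · rw [tau, tau, he, sInf_empty, top_add]
      exact le_top
    · obtain ⟨n, hn, -, hs⟩ := csInf_mem hne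
      rw [show tau (fun n => r (n + 1)) i = n from hn.symm]
      refine sInf_le ⟨n + 1, by push_cast; rfl, by omega, ?_⟩
      rw [Finset.sum_range_succ', hs, ← h, add_comm]
  · rintro _ ⟨n, rfl, hn, hs⟩
    obtain ⟨m, rfl⟩ := Nat.exists_eq_add_of_le' hn
    rw [Finset.sum_range_succ', ← h, add_comm, add_left_cancel_iff] at hs
    push_cast
    gcongr
    refine sInf_le ⟨m, rfl, ?_, hs⟩
    rcases Nat.eq_zero_or_pos m with rfl | hm
    · exact absurd (by simpa using hs.symm) hi
    · exact hm

section HittingSum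

/-- The sum of `(1/2)^τ_j` over `j = a + 1, a + 3, a + 5, …`. -/
noncomputable def hittingSum (r : ℕ → ℝ) (a : ℕ) : ℝ :=
  ∑' k : ℕ, halfPow (tau r (a + 2 * k + 1))

theorem hittingSum_nonneg (r : ℕ → ℝ) (a : ℕ) : 0 ≤ hittingSum r a :=
  tsum_nonneg fun _ => halfPow_nonneg _

variable {r : ℕ → ℝ}

theorem hittingSum_eq_half {a b : ℕ} (h : r 0 + b = a) :
    hittingSum r a = hittingSum (fun n => r (n + 1)) b / 2 := by
  unfold hittingSum
  rw [← tsum_div_const]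
  refine tsum_congr fun k => ?_
  rw [← halfPow_add_one, tau_eq_tau_shift_add_one (i := b + 2 * k + 1)]
  · push_cast; rw [← h]; ring
  · omega

variable (hr : ∀ n, r n = 1 ∨ r n = -1)
include hr

theorem natCast_le_tau (j : ℕ) : (j : ℕ∞) ≤ tau r j := by
  refine le_sInf ?_
  rintro _ ⟨n, rfl, -, hs⟩
  have h : (∑ i ∈ Finset.range n, r i) ≤ ∑ i ∈ Finset.range n, (1 : ℝ) :=
    Finset.sum_le_sum fun i _ => by rcases hr i with h | h <;> rw [h]; norm_num
  rw [hs] at h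
  simp only [Finset.sum_const, Finset.card_range, nsmul_eq_mul, mul_one, Int.cast_natCast,
    Nat.cast_le] at h
  exact_mod_cast h

theorem halfPow_tau_le (a k : ℕ) : halfPow (tau r (a + 2 * k + 1)) ≤ (1 / 2) ^ k := by
  have h := halfPow_le_of_le (natCast_le_tau hr (a + 2 * k + 1))
  push_cast at h
  exact h.trans (pow_le_pow_of_le_one (by norm_num) (by norm_num) (by omega))

theorem summable_halfPow_tau (a : ℕ) :
    Summable fun k : ℕ => halfPow (tau r (a + 2 * k + 1)) :=
  summable_geometric_two.of_nonneg_of_le (fun _ => halfPow_nonneg _) (halfPow_tau_le hr a)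

theorem hittingSum_le_two (a : ℕ) : hittingSum r a ≤ 2 :=
  tsum_geometric_two ▸
    (summable_halfPow_tau hr a).tsum_le_tsum (halfPow_tau_le hr a) summable_geometric_two

theorem hittingSum_zero_of_one (h : r 0 = 1) :
    hittingSum r 0 = (1 + hittingSum (fun n => r (n + 1)) 1) / 2 := by
  unfold hittingSum
  rw [(summable_halfPow_tau hr 0).tsum_eq_zero_add, add_div, ← tsum_div_const]
  congr 1
  · rw [tau_eq_one (by simpa using h)]
    exact pow_one _
  · refine tsum_congr fun k => ?_
    rw [← halfPow_add_one, tau_eq_tau_shift_add_one (i := ((1 : ℕ) : ℤ) + 2 * k + 1)]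
    · push_cast; rw [h]; ring
    · omega

/-- One step of the walk: either the level `a` moves to `a - r 0 ≥ 0`, or it is reflected at `0`. -/
theorem exists_level_or_reflected (a : ℕ) : (∃ b : ℕ, r 0 + b = a) ∨ (a = 0 ∧ r 0 = 1) := by
  rcases hr 0 with h | h
  · rcases a with _ | b
    · exact Or.inr ⟨rfl, h⟩
    · exact Or.inl ⟨b, by rw [h]; push_cast; ring⟩
  · exact Or.inl ⟨a + 1, by rw [h]; push_cast; ring⟩

end HittingSum

theorem takagi_sub_le_hittingSum_add (n : ℕ) :
    ∀ {r : ℕ → ℝ}, (∀ n, r n = 1 ∨ r n = -1) → ∀ (a : ℕ) {x : ℝ}, 0 ≤ x → x ≤ 1 →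
      takagi r x - a * x ≤ hittingSum r a + 2 * (1 / 2) ^ n := by
  induction n with
  | zero =>
    intro r hr a x h0 _
    have := takagi_le_two hr x
    have := hittingSum_nonneg r a
    have : 0 ≤ a * x := by positivity
    linarith
  | succ n ih =>
    intro r hr a
    have key : ∀ y : ℝ, 0 ≤ y → y ≤ 1 →
        takagi r (y / 2) - a * (y / 2) ≤ hittingSum r a + 2 * (1 / 2) ^ (n + 1) := by
      intro y h0 h1
      have hr' : ∀ n, r (n + 1) = 1 ∨ r (n + 1) = -1 := fun n => hr (n + 1)
      rw [takagi_half hr h0 h1, pow_succ]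
      rcases exists_level_or_reflected hr a with ⟨b, hb⟩ | ⟨rfl, h⟩
      · have := ih hr' b h0 h1
        rw [hittingSum_eq_half hb, ← hb]
        linarith
      · have := ih hr' 1 (sub_nonneg.2 h1) (sub_le_self 1 h0)
        rw [takagi_one_sub] at this
        push_cast at this ⊢
        rw [hittingSum_zero_of_one hr h, h]
        linarith
    intro x h0 h1
    rcases le_total x (1 / 2) with hx | hx
    · simpa using key (2 * x) (by linarith) (by linarith)
    · have h := key (2 * (1 - x)) (by linarith) (by linarith)
      rw [mul_div_cancel_left₀ _ two_ne_zero, takagi_one_sub] at h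
      have : (a : ℝ) * (1 - x) ≤ a * x := by gcongr; linarith
      linarith

theorem exists_hittingSum_le_takagi_sub_add (n : ℕ) :
    ∀ {r : ℕ → ℝ}, (∀ n, r n = 1 ∨ r n = -1) → ∀ a : ℕ, ∃ x : ℝ, 0 ≤ x ∧ x ≤ 1 ∧
      hittingSum r a ≤ takagi r x - a * x + 2 * (1 / 2) ^ n := by
  induction n with
  | zero =>
    intro r hr a
    refine ⟨0, le_rfl, zero_le_one, ?_⟩
    have := hittingSum_le_two hr a
    have : takagi r 0 = 0 := by simp [takagi, phi]
    simpa [this]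
  | succ n ih =>
    intro r hr a
    have hr' : ∀ n, r (n + 1) = 1 ∨ r (n + 1) = -1 := fun n => hr (n + 1)
    rcases exists_level_or_reflected hr a with ⟨b, hb⟩ | ⟨rfl, h⟩
    · obtain ⟨y, h0, h1, hy⟩ := ih hr' b
      refine ⟨y / 2, by linarith, by linarith, ?_⟩
      rw [takagi_half hr h0 h1, pow_succ, hittingSum_eq_half hb, ← hb]
      linarith
    · obtain ⟨y, h0, h1, hy⟩ := ih hr' 1
      refine ⟨(1 - y) / 2, by linarith, by linarith, ?_⟩
      rw [takagi_half hr (sub_nonneg.2 h1) (sub_le_self 1 h0), takagi_one_sub, pow_succ,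
        hittingSum_zero_of_one hr h, h]
      push_cast at hy ⊢
      linarith

theorem le_of_forall_le_add_two_mul_half_pow {a b : ℝ}
    (h : ∀ n : ℕ, a ≤ b + 2 * (1 / 2) ^ n) : a ≤ b := by
  have h0 := tendsto_pow_atTop_nhds_zero_of_lt_one (r := (1 / 2 : ℝ)) (by norm_num) (by norm_num)
  have h1 := (h0.const_mul 2).const_add b
  rw [mul_zero, add_zero] at h1
  exact ge_of_tendsto' h1 h

/-- The maximum value of a signed Takagi function `f` over `[0,1]` is
`M(f) = ∑_{k=1}^∞ (1/2)^{τ_{2k-1}}`. -/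
theorem signed_takagi_max (r : ℕ → ℝ) (hr : ∀ n, r n = 1 ∨ r n = -1) :
    IsGreatest (takagi r '' Set.Icc 0 1)
      (∑' k : ℕ, halfPow (tau r (2 * (k : ℤ) + 1))) := by
  have hsum : (∑' k : ℕ, halfPow (tau r (2 * (k : ℤ) + 1))) = hittingSum r 0 := by
    simp [hittingSum]
  rw [hsum]
  have upper : ∀ x ∈ Set.Icc (0 : ℝ) 1, takagi r x ≤ hittingSum r 0 := fun x hx =>
    le_of_forall_le_add_two_mul_half_pow fun n => by
      simpa using takagi_sub_le_hittingSum_add n hr 0 hx.1 hx.2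
  obtain ⟨x, hx, hmax⟩ := isCompact_Icc.exists_isMaxOn (Set.nonempty_Icc.2 zero_le_one)
    (continuous_takagi hr).continuousOn
  refine ⟨⟨x, hx, (upper x hx).antisymm (le_of_forall_le_add_two_mul_half_pow fun n => ?_)⟩,
    Set.forall_mem_image.2 upper⟩
  obtain ⟨y, h0, h1, hy⟩ := exists_hittingSum_le_takagi_sub_add n hr 0
  have : takagi r y ≤ takagi r x := hmax ⟨h0, h1⟩
  rw [Nat.cast_zero, zero_mul, sub_zero] at hy
  linarith
end

section
/- For Lebesgue-almost every y ∈ ℝ, the level set L_f(y) = {x ∈ [0,1] : f(x) = y} is a finite set. -/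
open MeasureTheory

namespace SignedTakagi

open scoped ENNReal Pointwise

/-! ### The distance to the nearest integer -/

lemma phi_eq_min (x : ℝ) : phi x = min (Int.fract x) (1 - Int.fract x) :=
  abs_sub_round_eq_min x

lemma phi_neg (x : ℝ) : phi (-x) = phi x := by
  rw [phi_eq_min, phi_eq_min]
  by_cases h : Int.fract x = 0
  · rw [h, Int.fract_neg_eq_zero.2 h]
  · rw [Int.fract_neg h, min_comm]
    congr 1
    ring

lemma phi_add_pow (x : ℝ) (n : ℕ) : phi (x + 2 ^ n) = phi x := by
  rw [phi_eq_min, phi_eq_min]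
  have : Int.fract (x + 2 ^ n) = Int.fract x := by
    simpa using Int.fract_add_natCast x (2 ^ n)
  rw [this]

lemma phi_of_le_half {x : ℝ} (h0 : 0 ≤ x) (h1 : x ≤ 1 / 2) : phi x = x := by
  rw [phi_eq_min, Int.fract_eq_self.2 ⟨h0, by linarith⟩, min_eq_left (by linarith)]

lemma phi_of_half_le {x : ℝ} (h0 : 1 / 2 ≤ x) (h1 : x ≤ 1) : phi x = 1 - x := by
  have h := phi_of_le_half (x := 1 - x) (by linarith) (by linarith)
  rw [← h, ← phi_neg (1 - x), ← phi_add_pow (-(1 - x)) 0]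
  congr 1
  ring

lemma abs_phi_le (x : ℝ) : |phi x| ≤ 1 := by
  have h := abs_sub_round x
  rw [phi, abs_abs]
  linarith

/-! ### Functional equations of signed Takagi functions -/

/-- The sequence `r` takes only the values `1` and `-1`. -/
def IsSign (r : ℕ → ℝ) : Prop := ∀ n, r n = 1 ∨ r n = -1

/-- The sequence `r` with its first term removed. -/
def tail (r : ℕ → ℝ) : ℕ → ℝ := fun n => r (n + 1)

lemma IsSign.tail {r : ℕ → ℝ} (hr : IsSign r) : IsSign (tail r) := fun n => hr (n + 1)

lemma IsSign.norm_term_le {r : ℕ → ℝ} (hr : IsSign r) (x : ℝ) (n : ℕ) :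
    ‖r n / 2 ^ n * phi (2 ^ n * x)‖ ≤ (1 / 2) ^ n := by
  have h1 : |r n| = 1 := by rcases hr n with h | h <;> simp [h]
  rw [Real.norm_eq_abs, abs_mul, abs_div, h1, abs_of_pos (by positivity : (0 : ℝ) < 2 ^ n),
    one_div_pow]
  exact mul_le_of_le_one_right (by positivity) (abs_phi_le _)

lemma IsSign.summable {r : ℕ → ℝ} (hr : IsSign r) (x : ℝ) :
    Summable fun n : ℕ => r n / 2 ^ n * phi (2 ^ n * x) :=
  Summable.of_norm_bounded summable_geometric_two (hr.norm_term_le x)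

lemma IsSign.abs_takagi_le {r : ℕ → ℝ} (hr : IsSign r) (x : ℝ) : |takagi r x| ≤ 2 :=
  tsum_of_norm_bounded hasSum_geometric_two (hr.norm_term_le x)

lemma takagi_add_one (r : ℕ → ℝ) (x : ℝ) : takagi r (x + 1) = takagi r x := by
  unfold takagi
  congr 1
  ext n
  rw [mul_add, mul_one, phi_add_pow]

lemma takagi_one_sub (r : ℕ → ℝ) (x : ℝ) : takagi r (1 - x) = takagi r x := by
  unfold takagi
  congr 1
  ext n
  rw [show (2 : ℝ) ^ n * (1 - x) = -(2 ^ n * x) + 2 ^ n by ring, phi_add_pow, phi_neg]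

lemma IsSign.takagi_eq {r : ℕ → ℝ} (hr : IsSign r) (x : ℝ) :
    takagi r x = r 0 * phi x + takagi (SignedTakagi.tail r) (2 * x) / 2 := by
  have h := (hr.summable x).tsum_eq_zero_add
  rw [takagi, h, takagi, ← tsum_div_const]
  congr 1
  · simp
  · congr 1
    ext n
    rw [SignedTakagi.tail, ← mul_assoc, ← pow_succ, pow_succ]
    ring

/-- A signed Takagi function with a linear term of slope `d` added. -/
noncomputable def tilted (r : ℕ → ℝ) (d : ℝ) (t : ℝ) : ℝ := d * t + takagi r t

lemma IsSign.tilted_left {r : ℕ → ℝ} (hr : IsSign r) (d : ℝ) {t : ℝ} (ht : t ∈ Set.Icc (0 : ℝ) 1) :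
    tilted r d (t / 2) = tilted (SignedTakagi.tail r) (d + r 0) t / 2 := by
  rw [tilted, tilted, hr.takagi_eq, phi_of_le_half (by linarith [ht.1]) (by linarith [ht.2]),
    mul_div_cancel₀ _ (two_ne_zero)]
  ring

lemma IsSign.tilted_right {r : ℕ → ℝ} (hr : IsSign r) (d : ℝ) {t : ℝ}
    (ht : t ∈ Set.Icc (0 : ℝ) 1) :
    tilted r d ((t + 1) / 2) =
      tilted (SignedTakagi.tail r) (d - r 0) t / 2 + (d + r 0) / 2 := by
  rw [tilted, tilted, hr.takagi_eq, phi_of_half_le (by linarith [ht.1]) (by linarith [ht.2]),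
    mul_div_cancel₀ _ (two_ne_zero), takagi_add_one]
  ring

/-- The affine map onto the half of `[0, 1]` where the slope increases. -/
noncomputable def up (r : ℕ → ℝ) (t : ℝ) : ℝ := if r 0 = 1 then t / 2 else (t + 1) / 2

/-- The affine map onto the half of `[0, 1]` where the slope decreases. -/
noncomputable def down (r : ℕ → ℝ) (t : ℝ) : ℝ := if r 0 = 1 then (t + 1) / 2 else t / 2

lemma up_mem {r : ℕ → ℝ} {t : ℝ} (ht : t ∈ Set.Icc (0 : ℝ) 1) : up r t ∈ Set.Icc (0 : ℝ) 1 := by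
  obtain ⟨h0, h1⟩ := ht
  unfold up
  split_ifs <;> constructor <;> linarith

lemma down_mem {r : ℕ → ℝ} {t : ℝ} (ht : t ∈ Set.Icc (0 : ℝ) 1) :
    down r t ∈ Set.Icc (0 : ℝ) 1 := by
  obtain ⟨h0, h1⟩ := ht
  unfold down
  split_ifs <;> constructor <;> linarith

lemma exists_up_or_down (r : ℕ → ℝ) {t : ℝ} (ht : t ∈ Set.Icc (0 : ℝ) 1) :
    ∃ s ∈ Set.Icc (0 : ℝ) 1, t = up r s ∨ t = down r s := by
  obtain ⟨h0, h1⟩ := ht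
  unfold up down
  rcases le_total t (1 / 2) with h | h
  · refine ⟨2 * t, ⟨by linarith, by linarith⟩, ?_⟩
    split_ifs
    · left; ring
    · right; ring
  · refine ⟨2 * t - 1, ⟨by linarith, by linarith⟩, ?_⟩
    split_ifs
    · right; ring
    · left; ring

lemma IsSign.exists_tilted_up {r : ℕ → ℝ} (hr : IsSign r) (d : ℝ) :
    ∃ a : ℝ, ∀ t ∈ Set.Icc (0 : ℝ) 1,
      tilted r d (up r t) = tilted (SignedTakagi.tail r) (d + 1) t / 2 + a := by
  rcases hr 0 with h | h
  · refine ⟨0, fun t ht => ?_⟩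
    rw [up, if_pos h, hr.tilted_left d ht, h, add_zero]
  · refine ⟨(d - 1) / 2, fun t ht => ?_⟩
    rw [up, if_neg (by norm_num [h]), hr.tilted_right d ht, h, sub_neg_eq_add, ← sub_eq_add_neg]

lemma IsSign.exists_tilted_down {r : ℕ → ℝ} (hr : IsSign r) (d : ℝ) :
    ∃ a : ℝ, ∀ t ∈ Set.Icc (0 : ℝ) 1,
      tilted r d (down r t) = tilted (SignedTakagi.tail r) (d - 1) t / 2 + a := by
  rcases hr 0 with h | h
  · refine ⟨(d + 1) / 2, fun t ht => ?_⟩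
    rw [down, if_pos h, hr.tilted_right d ht, h]
  · refine ⟨0, fun t ht => ?_⟩
    rw [down, if_neg (by norm_num [h]), hr.tilted_left d ht, h, add_zero, ← sub_eq_add_neg]

/-! ### Points where the slope of the partial sums first vanishes at a given level -/

/-- The points at which, starting from slope `d`, the slope walk first hits `0` after `k` steps. -/
noncomputable def firstHit : ℕ → (ℕ → ℝ) → ℕ → Set ℝ
  | 0, _, 0 => Set.Icc 0 1
  | 0, _, _ + 1 => ∅
  | _ + 1, _, 0 => ∅
  | k + 1, r, d + 1 =>
    up r '' firstHit k (tail r) (d + 2) ∪ down r '' firstHit k (tail r) d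

/-- The probability that simple random walk started at `d` first hits `0` after `k` steps. -/
noncomputable def hitProb : ℕ → ℕ → ℝ≥0∞
  | 0, 0 => 1
  | 0, _ + 1 => 0
  | _ + 1, 0 => 0
  | k + 1, d + 1 => hitProb k (d + 2) / 2 + hitProb k d / 2

lemma sum_hitProb_le (K d : ℕ) : ∑ k ∈ Finset.range K, hitProb k d ≤ 1 := by
  induction K generalizing d with
  | zero => simp
  | succ K ih =>
    rw [Finset.sum_range_succ']
    cases d with
    | zero => simp [hitProb]
    | succ d =>
      simp only [hitProb, add_zero, Finset.sum_add_distrib, div_eq_mul_inv, ← Finset.sum_mul]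
      calc _ ≤ (1 : ℝ≥0∞) * 2⁻¹ + 1 * 2⁻¹ := by gcongr <;> exact ih _
        _ = 1 := by rw [one_mul, ENNReal.inv_two_add_inv_two]

lemma tsum_hitProb_le (d : ℕ) : ∑' k, hitProb k d ≤ 1 :=
  ENNReal.tsum_le_of_sum_range_le fun K => sum_hitProb_le K d

lemma firstHit_subset (k : ℕ) (r : ℕ → ℝ) (d : ℕ) : firstHit k r d ⊆ Set.Icc 0 1 := by
  induction k generalizing r d with
  | zero => cases d <;> simp [firstHit]
  | succ k ih =>
    cases d with
    | zero => simp [firstHit]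
    | succ d =>
      rintro t (⟨s, hs, rfl⟩ | ⟨s, hs, rfl⟩)
      · exact up_mem (ih _ _ hs)
      · exact down_mem (ih _ _ hs)

lemma volume_image_half (a : ℝ) (s : Set ℝ) :
    volume ((fun y : ℝ => y / 2 + a) '' s) = volume s / 2 := by
  have h : (fun y : ℝ => y / 2 + a) '' s = (fun y => y + a) '' ((2⁻¹ : ℝ) • s) := by
    rw [← Set.image_smul, Set.image_image]
    congr 1
    ext y
    simp only [smul_eq_mul]
    ring
  rw [h, Set.image_add_right, measure_preimage_add_right, Measure.addHaar_smul]
  rw [Module.finrank_self, pow_one, abs_of_pos (by norm_num : (0 : ℝ) < 2⁻¹),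
    ENNReal.ofReal_inv_of_pos two_pos, ENNReal.ofReal_ofNat, mul_comm, div_eq_mul_inv]

lemma IsSign.volume_image_firstHit_le {r : ℕ → ℝ} (hr : IsSign r) (k d : ℕ) :
    volume (tilted r d '' firstHit k r d) ≤ 4 * hitProb k d := by
  induction k generalizing r d with
  | zero =>
    cases d with
    | zero =>
      calc _ ≤ volume (Set.Icc (-2 : ℝ) 2) := by
            refine measure_mono ?_
            rintro _ ⟨t, -, rfl⟩
            simpa [tilted] using abs_le.1 (hr.abs_takagi_le t)
        _ = 4 * hitProb 0 0 := by
            rw [Real.volume_Icc, hitProb, mul_one]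
            norm_num
    | succ d => simp [firstHit]
  | succ k ih =>
    cases d with
    | zero => simp [firstHit]
    | succ d =>
      obtain ⟨a, ha⟩ := hr.exists_tilted_up (d + 1 : ℕ)
      obtain ⟨b, hb⟩ := hr.exists_tilted_down (d + 1 : ℕ)
      rw [firstHit, Set.image_union, hitProb, mul_add]
      refine (measure_union_le _ _).trans (add_le_add ?_ ?_)
      · calc _ ≤ volume ((fun y : ℝ => y / 2 + a) ''
                (tilted (SignedTakagi.tail r) (d + 2 : ℕ) ''
                  firstHit k (SignedTakagi.tail r) (d + 2))) := by
              refine measure_mono ?_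
              rintro _ ⟨_, ⟨s, hs, rfl⟩, rfl⟩
              refine ⟨_, ⟨s, hs, rfl⟩, ?_⟩
              rw [ha s (firstHit_subset _ _ _ hs)]
              push_cast
              ring_nf
          _ ≤ _ := by
              rw [volume_image_half, ← mul_div_assoc]
              gcongr
              exact ih hr.tail _
      · calc _ ≤ volume ((fun y : ℝ => y / 2 + b) ''
                (tilted (SignedTakagi.tail r) d '' firstHit k (SignedTakagi.tail r) d)) := by
              refine measure_mono ?_
              rintro _ ⟨_, ⟨s, hs, rfl⟩, rfl⟩
              refine ⟨_, ⟨s, hs, rfl⟩, ?_⟩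
              rw [hb s (firstHit_subset _ _ _ hs)]
              push_cast
              ring_nf
          _ ≤ _ := by
              rw [volume_image_half, ← mul_div_assoc]
              gcongr
              exact ih hr.tail _

/-- The values taken infinitely often by `g` on `s`. -/
def infiniteValues (g : ℝ → ℝ) (s : Set ℝ) : Set ℝ := {y | (s ∩ g ⁻¹' {y}).Infinite}

lemma infiniteValues_union (g : ℝ → ℝ) (s t : Set ℝ) :
    infiniteValues g (s ∪ t) = infiniteValues g s ∪ infiniteValues g t := by
  ext y
  simp only [infiniteValues, Set.mem_union, Set.mem_ofPred_eq, Set.union_inter_distrib_right,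
    Set.infinite_union]

lemma infiniteValues_image_subset {g h u : ℝ → ℝ} {s : Set ℝ} {a : ℝ}
    (H : ∀ t ∈ s, g (u t) = h t / 2 + a) :
    infiniteValues g (u '' s) ⊆ (fun y : ℝ => y / 2 + a) '' infiniteValues h s := by
  intro y hy
  refine ⟨2 * (y - a), ?_, by ring⟩
  refine Set.Infinite.of_image u (hy.mono ?_)
  rintro _ ⟨⟨t, ht, rfl⟩, hty⟩
  refine ⟨t, ⟨ht, ?_⟩, rfl⟩
  have h1 := H t ht
  rw [Set.mem_preimage, Set.mem_singleton_iff] at hty ⊢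
  linarith

lemma volume_infiniteValues_image_le {g h u : ℝ → ℝ} {s : Set ℝ} {a : ℝ}
    (H : ∀ t ∈ s, g (u t) = h t / 2 + a) :
    volume (infiniteValues g (u '' s)) ≤ volume (infiniteValues h s) / 2 := by
  rw [← volume_image_half a]
  exact measure_mono (infiniteValues_image_subset H)

lemma IsSign.volume_infiniteValues_firstHit_le {c : ℝ≥0∞}
    (hc : ∀ r, IsSign r → volume (infiniteValues (tilted r 0) (Set.Icc 0 1)) ≤ c)
    {r : ℕ → ℝ} (hr : IsSign r) (k d : ℕ) :
    volume (infiniteValues (tilted r d) (firstHit k r d)) ≤ c * hitProb k d := by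
  induction k generalizing r d with
  | zero =>
    cases d with
    | zero => simpa [firstHit, hitProb] using hc r hr
    | succ d => simp [firstHit, infiniteValues]
  | succ k ih =>
    cases d with
    | zero => simp [firstHit, infiniteValues]
    | succ d =>
      obtain ⟨a, ha⟩ := hr.exists_tilted_up (d + 1 : ℕ)
      obtain ⟨b, hb⟩ := hr.exists_tilted_down (d + 1 : ℕ)
      rw [show ((d + 1 : ℕ) : ℝ) + 1 = (d + 2 : ℕ) by push_cast; ring] at ha
      rw [show ((d + 1 : ℕ) : ℝ) - 1 = d by push_cast; ring] at hb
      rw [firstHit, infiniteValues_union, hitProb, mul_add, ← mul_div_assoc, ← mul_div_assoc]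
      refine (measure_union_le _ _).trans (add_le_add ?_ ?_)
      · refine (volume_infiniteValues_image_le
          fun t ht => ha t (firstHit_subset _ _ _ ht)).trans ?_
        gcongr
        exact ih hr.tail _
      · refine (volume_infiniteValues_image_le
          fun t ht => hb t (firstHit_subset _ _ _ ht)).trans ?_
        gcongr
        exact ih hr.tail _

/-! ### Points where the slope of the partial sums never vanishes -/

/-- The points at which the slope walk started from `d` never hits `0`. -/
def neverHit (r : ℕ → ℝ) (d : ℕ) : Set ℝ := Set.Icc 0 1 \ ⋃ k, firstHit k r d

lemma notMem_neverHit_zero (r : ℕ → ℝ) (t : ℝ) : t ∉ neverHit r 0 :=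
  fun ht => ht.2 (Set.mem_iUnion.2 ⟨0, ht.1⟩)

lemma mem_neverHit_of_up {r : ℕ → ℝ} {d : ℕ} {s : ℝ} (hs : s ∈ Set.Icc (0 : ℝ) 1)
    (h : up r s ∈ neverHit r (d + 1)) : s ∈ neverHit (tail r) (d + 2) := by
  refine ⟨hs, fun hk => h.2 ?_⟩
  obtain ⟨k, hk⟩ := Set.mem_iUnion.1 hk
  exact Set.mem_iUnion.2 ⟨k + 1, Or.inl ⟨s, hk, rfl⟩⟩

lemma mem_neverHit_of_down {r : ℕ → ℝ} {d : ℕ} {s : ℝ} (hs : s ∈ Set.Icc (0 : ℝ) 1)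
    (h : down r s ∈ neverHit r (d + 1)) : s ∈ neverHit (tail r) d := by
  refine ⟨hs, fun hk => h.2 ?_⟩
  obtain ⟨k, hk⟩ := Set.mem_iUnion.1 hk
  exact Set.mem_iUnion.2 ⟨k + 1, Or.inr ⟨s, hk, rfl⟩⟩

/-- The left half of a never-hitting set: the slope stays positive and changes by `r 0`. -/
lemma IsSign.exists_left {r : ℕ → ℝ} (hr : IsSign r) {d : ℕ} {t : ℝ} (ht : t ∈ neverHit r (d + 1))
    (h : t ≤ 1 / 2) : ∃ e : ℕ, (e + 1 : ℝ) = d + 1 + r 0 ∧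
      2 * t ∈ neverHit (SignedTakagi.tail r) (e + 1) ∧
      tilted r (d + 1) t = tilted (SignedTakagi.tail r) (e + 1) (2 * t) / 2 := by
  have hs : 2 * t ∈ Set.Icc (0 : ℝ) 1 := ⟨by linarith [ht.1.1], by linarith⟩
  have key := hr.tilted_left (d + 1) hs
  rw [mul_div_cancel_left₀ _ two_ne_zero] at key
  rcases hr 0 with h0 | h0
  · refine ⟨d + 1, by push_cast; linarith, mem_neverHit_of_up hs ?_, ?_⟩
    · rwa [up, if_pos h0, mul_div_cancel_left₀ _ two_ne_zero]
    · rw [key, h0]; push_cast; rfl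
  · have hd : 2 * t ∈ neverHit (SignedTakagi.tail r) d := mem_neverHit_of_down hs <| by
      rwa [down, if_neg (by norm_num [h0]), mul_div_cancel_left₀ _ two_ne_zero]
    cases d with
    | zero => exact absurd hd (notMem_neverHit_zero _ _)
    | succ e =>
      refine ⟨e, by push_cast; linarith, hd, ?_⟩
      rw [key, h0]; push_cast; ring_nf

/-- The right half of a never-hitting set: the slope stays positive and changes by `-r 0`. -/
lemma IsSign.exists_right {r : ℕ → ℝ} (hr : IsSign r) {d : ℕ} {t : ℝ}
    (ht : t ∈ neverHit r (d + 1)) (h : 1 / 2 ≤ t) : ∃ e : ℕ, (e + 1 : ℝ) = d + 1 - r 0 ∧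
      2 * t - 1 ∈ neverHit (SignedTakagi.tail r) (e + 1) ∧
      tilted r (d + 1) t =
        tilted (SignedTakagi.tail r) (e + 1) (2 * t - 1) / 2 + (d + 1 + r 0) / 2 := by
  have hs : 2 * t - 1 ∈ Set.Icc (0 : ℝ) 1 := ⟨by linarith, by linarith [ht.1.2]⟩
  have ht' : (2 * t - 1 + 1) / 2 = t := by ring
  have key := hr.tilted_right (d + 1) hs
  rw [ht'] at key
  rcases hr 0 with h0 | h0
  · have hd : 2 * t - 1 ∈ neverHit (SignedTakagi.tail r) d := mem_neverHit_of_down hs <| by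
      rwa [down, if_pos h0, ht']
    cases d with
    | zero => exact absurd hd (notMem_neverHit_zero _ _)
    | succ e =>
      refine ⟨e, by push_cast; linarith, hd, ?_⟩
      rw [key, h0]; push_cast; ring_nf
  · refine ⟨d + 1, by push_cast; linarith, mem_neverHit_of_up hs ?_, ?_⟩
    · rwa [up, if_neg (by norm_num [h0]), ht']
    · rw [key, h0, sub_neg_eq_add]; push_cast; rfl

lemma IsSign.tilted_bounds_approx {r : ℕ → ℝ} (hr : IsSign r) (j : ℕ) {d : ℕ} {t : ℝ}
    (ht : t ∈ neverHit r (d + 1)) :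
    -(2 * (1 / 2) ^ j) ≤ tilted r (d + 1) t ∧
      tilted r (d + 1) t ≤ d + 1 + 2 * (1 / 2) ^ j := by
  have hd : (0 : ℝ) ≤ d := Nat.cast_nonneg d
  have hr0 : -1 ≤ r 0 ∧ r 0 ≤ 1 := by rcases hr 0 with h | h <;> norm_num [h]
  induction j generalizing r d t with
  | zero =>
    obtain ⟨h1, h2⟩ := abs_le.1 (hr.abs_takagi_le t)
    obtain ⟨h3, h4⟩ := ht.1
    unfold tilted
    constructor <;> nlinarith
  | succ j ih =>
    have hr0' : -1 ≤ SignedTakagi.tail r 0 ∧ SignedTakagi.tail r 0 ≤ 1 := by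
      rcases hr.tail 0 with h | h <;> norm_num [h]
    rw [pow_succ]
    rcases le_total t (1 / 2) with h | h
    · obtain ⟨e, he, hs, hv⟩ := hr.exists_left ht h
      obtain ⟨h1, h2⟩ := ih hr.tail hs (Nat.cast_nonneg e) hr0'
      rw [hv]
      constructor <;> linarith
    · obtain ⟨e, he, hs, hv⟩ := hr.exists_right ht h
      obtain ⟨h1, h2⟩ := ih hr.tail hs (Nat.cast_nonneg e) hr0'
      rw [hv]
      constructor <;> linarith

lemma IsSign.tilted_bounds {r : ℕ → ℝ} (hr : IsSign r) {d : ℕ} {t : ℝ}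
    (ht : t ∈ neverHit r (d + 1)) :
    0 ≤ tilted r (d + 1) t ∧ tilted r (d + 1) t ≤ d + 1 := by
  have hlim : Filter.Tendsto (fun j : ℕ => 2 * (1 / 2 : ℝ) ^ j) Filter.atTop (nhds 0) := by
    simpa using (tendsto_pow_atTop_nhds_zero_of_lt_one (r := (1 / 2 : ℝ))
      (by norm_num) (by norm_num)).const_mul 2
  constructor
  · have := ge_of_tendsto' (hlim.add_const (tilted r (d + 1) t)) fun j => by
      have := (hr.tilted_bounds_approx j ht).1
      show (0 : ℝ) ≤ _
      linarith
    linarith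
  · have := ge_of_tendsto' (hlim.const_add (d + 1 : ℝ)) fun j =>
      (hr.tilted_bounds_approx j ht).2
    linarith

/-- The values of a tilted signed Takagi function at rational points of `[0, 1]`. -/
def rationalValues (r : ℕ → ℝ) (d : ℝ) : Set ℝ :=
  tilted r d '' {t | t ∈ Set.Icc (0 : ℝ) 1 ∧ t ∈ Set.range ((↑) : ℚ → ℝ)}

lemma countable_rationalValues (r : ℕ → ℝ) (d : ℝ) : (rationalValues r d).Countable :=
  ((Set.countable_range _).mono fun _ h => h.2).image _

lemma IsSign.mem_rationalValues_left {r : ℕ → ℝ} (hr : IsSign r) {d y : ℝ}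
    (h : y ∈ rationalValues (SignedTakagi.tail r) (d + r 0)) : y / 2 ∈ rationalValues r d := by
  obtain ⟨_, ⟨hq, q, rfl⟩, rfl⟩ := h
  refine ⟨q / 2, ⟨⟨?_, ?_⟩, q / 2, by push_cast; rfl⟩, hr.tilted_left d hq⟩
  · linarith [hq.1]
  · linarith [hq.2]

lemma IsSign.mem_rationalValues_right {r : ℕ → ℝ} (hr : IsSign r) {d y : ℝ}
    (h : y ∈ rationalValues (SignedTakagi.tail r) (d - r 0)) :
    y / 2 + (d + r 0) / 2 ∈ rationalValues r d := by
  obtain ⟨_, ⟨hq, q, rfl⟩, rfl⟩ := h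
  refine ⟨(q + 1) / 2, ⟨⟨?_, ?_⟩, (q + 1) / 2, by push_cast; rfl⟩, hr.tilted_right d hq⟩
  · linarith [hq.1]
  · linarith [hq.2]

lemma IsSign.half_mem_rationalValues {r : ℕ → ℝ} (hr : IsSign r) (d : ℝ) :
    (d + r 0) / 2 ∈ rationalValues r d := by
  have h0 : tilted (SignedTakagi.tail r) (d - r 0) 0 = 0 := by
    simp [tilted, takagi, phi]
  have := hr.mem_rationalValues_right (d := d) (y := 0) ⟨0, ⟨by simp, 0, by simp⟩, h0⟩
  simpa using this

lemma IsSign.mem_rationalValues_of_eq {r : ℕ → ℝ} (hr : IsSign r) (j : ℕ) {d : ℕ} {t t' : ℝ}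
    (ht : t ∈ neverHit r (d + 1)) (ht' : t' ∈ neverHit r (d + 1))
    (hlt : (1 / 2) ^ j < t' - t) (heq : tilted r (d + 1) t = tilted r (d + 1) t') :
    tilted r (d + 1) t ∈ rationalValues r (d + 1) := by
  induction j generalizing r d t t' with
  | zero =>
    have := ht.1.1
    have := ht'.1.2
    rw [pow_zero] at hlt
    linarith
  | succ j ih =>
    have hpos : (0 : ℝ) < (1 / 2) ^ (j + 1) := by positivity
    have hpow : (1 / 2 : ℝ) ^ j = 2 * (1 / 2) ^ (j + 1) := by rw [pow_succ]; ring
    rcases le_total t' (1 / 2) with h' | h'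
    · obtain ⟨e, he, hs, hv⟩ := hr.exists_left ht (by linarith)
      obtain ⟨e', he', hs', hv'⟩ := hr.exists_left ht' h'
      obtain rfl : e = e' := by
        have : (e : ℝ) = e' := by linarith
        exact_mod_cast this
      rw [hv]
      refine hr.mem_rationalValues_left ?_
      rw [← he]
      exact ih hr.tail hs hs' (by linarith) (by linarith)
    rcases le_total t (1 / 2) with h | h
    · obtain ⟨e, he, hs, hv⟩ := hr.exists_left ht h
      obtain ⟨e', he', hs', hv'⟩ := hr.exists_right ht' h'
      have h1 := (hr.tail.tilted_bounds hs).2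
      have h2 := (hr.tail.tilted_bounds hs').1
      have : tilted r (d + 1) t = (d + 1 + r 0) / 2 := by linarith
      rw [this]
      exact hr.half_mem_rationalValues _
    · obtain ⟨e, he, hs, hv⟩ := hr.exists_right ht h
      obtain ⟨e', he', hs', hv'⟩ := hr.exists_right ht' h'
      obtain rfl : e = e' := by
        have : (e : ℝ) = e' := by linarith
        exact_mod_cast this
      rw [hv]
      refine hr.mem_rationalValues_right ?_
      rw [← he]
      exact ih hr.tail hs hs' (by linarith) (by linarith)

lemma IsSign.subsingleton_neverHit {r : ℕ → ℝ} (hr : IsSign r) {d : ℕ} {y : ℝ}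
    (hy : y ∉ rationalValues r (d + 1)) :
    (neverHit r (d + 1) ∩ tilted r (d + 1) ⁻¹' {y}).Subsingleton := by
  have key : ∀ t ∈ neverHit r (d + 1) ∩ tilted r (d + 1) ⁻¹' {y},
      ∀ t' ∈ neverHit r (d + 1) ∩ tilted r (d + 1) ⁻¹' {y}, t' ≤ t := by
    rintro t ⟨ht, hty⟩ t' ⟨ht', hty'⟩
    by_contra! hlt
    obtain ⟨j, hj⟩ := exists_pow_lt_of_lt_one (sub_pos.2 hlt) (by norm_num : (1 / 2 : ℝ) < 1)
    rw [Set.mem_preimage, Set.mem_singleton_iff] at hty hty'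
    exact hy (hty ▸ hr.mem_rationalValues_of_eq j ht ht' hj (hty.trans hty'.symm))
  exact fun t ht t' ht' => le_antisymm (key t' ht' t ht) (key t ht t' ht')

/-! ### Almost every level set is finite -/

lemma IsSign.volume_infiniteValues_succ_le {c : ℝ≥0∞}
    (hc : ∀ r, IsSign r → volume (infiniteValues (tilted r 0) (Set.Icc 0 1)) ≤ c)
    {r : ℕ → ℝ} (hr : IsSign r) (d : ℕ) :
    volume (infiniteValues (tilted r (d + 1)) (Set.Icc 0 1)) ≤ c := by
  have hsum : ∑' k, volume (tilted r (d + 1 : ℕ) '' firstHit k r (d + 1)) ≠ ∞ := by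
    refine ne_top_of_le_ne_top (b := 4 * 1) (by norm_num) ?_
    refine (ENNReal.tsum_le_tsum fun k => hr.volume_image_firstHit_le k (d + 1)).trans ?_
    rw [ENNReal.tsum_mul_left]
    gcongr
    exact tsum_hitProb_le _
  have hbc := ae_eventually_notMem hsum
  have hrat : ∀ᵐ y : ℝ, y ∉ rationalValues r (d + 1) :=
    (countable_rationalValues r (d + 1)).ae_notMem volume
  have hle : infiniteValues (tilted r (d + 1)) (Set.Icc 0 1) ≤ᵐ[volume]
      ⋃ k, infiniteValues (tilted r (d + 1 : ℕ)) (firstHit k r (d + 1)) := by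
    filter_upwards [hbc, hrat] with y hy hyr hinf
    push_cast at hy ⊢
    by_contra hnot
    obtain ⟨K, hK⟩ := Filter.eventually_atTop.1 hy
    have hfin : ∀ k, (firstHit k r (d + 1) ∩ tilted r (d + 1) ⁻¹' {y}).Finite := fun k => by
      by_contra hk
      exact hnot (Set.mem_iUnion.2 ⟨k, hk⟩)
    refine hinf (((hr.subsingleton_neverHit hyr).finite.union
      ((Set.finite_lt_nat K).biUnion fun k _ => hfin k)).subset ?_)
    rintro t ⟨ht, hty⟩
    by_cases hn : t ∈ neverHit r (d + 1)
    · exact Or.inl ⟨hn, hty⟩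
    · have : t ∈ ⋃ k, firstHit k r (d + 1) := by
        by_contra h
        exact hn ⟨ht, h⟩
      obtain ⟨k, hk⟩ := Set.mem_iUnion.1 this
      refine Or.inr (Set.mem_biUnion (x := k) ?_ ⟨hk, hty⟩)
      by_contra hlt
      exact hK k (not_lt.1 hlt) ⟨t, hk, hty⟩
  calc _ ≤ _ := measure_mono_ae hle
    _ ≤ ∑' k, volume (infiniteValues (tilted r (d + 1 : ℕ)) (firstHit k r (d + 1))) :=
      measure_iUnion_le _
    _ ≤ ∑' k, c * hitProb k (d + 1) :=
      ENNReal.tsum_le_tsum fun k => hr.volume_infiniteValues_firstHit_le hc k (d + 1)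
    _ ≤ c := by
      rw [ENNReal.tsum_mul_left]
      exact mul_le_of_le_one_right' (tsum_hitProb_le _)

lemma infiniteValues_zero_subset (r : ℕ → ℝ) :
    infiniteValues (tilted r 0) (Set.Icc 0 1) ⊆
      infiniteValues (tilted r 0) (up r '' Set.Icc 0 1) := by
  intro y hy hfin
  refine hy ((hfin.union (hfin.image fun t => 1 - t)).subset ?_)
  rintro t ⟨ht, hty⟩
  obtain ⟨s, hs, rfl | rfl⟩ := exists_up_or_down r ht
  · exact Or.inl ⟨⟨s, hs, rfl⟩, hty⟩
  · have hrefl : up r (1 - s) = 1 - down r s := by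
      unfold up down
      split_ifs <;> ring
    refine Or.inr ⟨up r (1 - s), ⟨⟨1 - s, ⟨by linarith [hs.2], by linarith [hs.1]⟩, rfl⟩, ?_⟩, ?_⟩
    · rw [hrefl, Set.mem_preimage, tilted, zero_mul, takagi_one_sub]
      simpa [tilted] using hty
    · simp [hrefl]

lemma IsSign.volume_infiniteValues_zero_le {c : ℝ≥0∞}
    (hc : ∀ r, IsSign r → volume (infiniteValues (tilted r 0) (Set.Icc 0 1)) ≤ c)
    {r : ℕ → ℝ} (hr : IsSign r) :
    volume (infiniteValues (tilted r 0) (Set.Icc 0 1)) ≤ c / 2 := by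
  obtain ⟨a, ha⟩ := hr.exists_tilted_up 0
  refine (measure_mono (infiniteValues_zero_subset r)).trans
    ((volume_infiniteValues_image_le ha).trans ?_)
  gcongr
  simpa using hr.tail.volume_infiniteValues_succ_le hc 0

lemma IsSign.volume_infiniteValues_zero {r : ℕ → ℝ} (hr : IsSign r) :
    volume (infiniteValues (tilted r 0) (Set.Icc 0 1)) = 0 := by
  set c : ℝ≥0∞ := ⨆ (r : ℕ → ℝ) (_ : IsSign r),
    volume (infiniteValues (tilted r 0) (Set.Icc 0 1))
  have hc : ∀ r, IsSign r → volume (infiniteValues (tilted r 0) (Set.Icc 0 1)) ≤ c :=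
    fun r hr => le_iSup₂ (f := fun (r : ℕ → ℝ) (_ : IsSign r) =>
      volume (infiniteValues (tilted r 0) (Set.Icc 0 1))) r hr
  have hhalf : c ≤ c / 2 := iSup₂_le fun r hr => hr.volume_infiniteValues_zero_le hc
  have htop : c ≠ ∞ := by
    refine ne_top_of_le_ne_top (b := 4 * hitProb 0 0) (by simp [hitProb]) ?_
    refine iSup₂_le fun r hr => le_trans (measure_mono ?_) (hr.volume_image_firstHit_le 0 0)
    intro y hy
    obtain ⟨t, ht, hty⟩ := Set.Infinite.nonempty hy
    exact ⟨t, ht, by simpa using hty⟩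
  have hzero : c = 0 := by
    by_contra h
    exact absurd hhalf (not_le.2 (ENNReal.half_lt_self h htop))
  exact le_antisymm (hzero ▸ hc r hr) zero_le

end SignedTakagi

/-- For Lebesgue-almost every `y`, the level set `L_f(y) = {x ∈ [0,1] : f(x) = y}`
of a signed Takagi function is finite. -/
theorem level_sets_finite_ae (r : ℕ → ℝ) (hr : ∀ n, r n = 1 ∨ r n = -1) :
    ∀ᵐ y : ℝ ∂volume, {x : ℝ | x ∈ Set.Icc (0 : ℝ) 1 ∧ takagi r x = y}.Finite := by
  have h0 : SignedTakagi.tilted r 0 = takagi r := by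
    ext x
    rw [SignedTakagi.tilted, zero_mul, zero_add]
  have h := SignedTakagi.IsSign.volume_infiniteValues_zero (r := r) hr
  rw [h0] at h
  exact ae_iff.2 h
end
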